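/- Let μ be a Borel measure on ℝ with μ({0}) = 0 and ∫_ℝ min(1,u²) μ(du) < ∞, satisfying μ((0,∞)) > 0 and ∫_{|u|≥1} e^{Cu} μ(du) < ∞ for every C ∈ ℝ. Let I ⊆ ℝ be an interval and f : I → ℝ a bounded measurable function with 0 < ∫_I f(s)² ds < ∞ and ∫_I max(f(s),0)² ds > 0. Assume Cramer's condition: there exists ρ > 0 such that the restriction ϰ of μ to [ρ,∞) satisfies sup_{|z|≥ε} |∫ e^{iyz} ϰ(dy)| < ϰ(ℝ) for every ε > 0. Then there exist q > 0 and ϑ > 0 such that for every ε > 0 and every z with |z| ≥ ε one has Θ(z,[q,∞)) ≥ ϑ · min(ε², 1). -/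

import Mathlib

open MeasureTheory Filter Set

/-- `Θ(z,A) = ∫_I ∫_ℝ 1_{f(s)u ∈ A} (1 − cos(f(s)zu)) μ(du) ds`. -/
noncomputable def kernelTheta (μ : Measure ℝ) (I : Set ℝ) (f : ℝ → ℝ) (z : ℝ) (A : Set ℝ) : ℝ :=
  ∫ s in I, ∫ u, A.indicator (fun _ => (1 : ℝ)) (f s * u) * (1 - Real.cos (f s * z * u)) ∂μ

/-- A measure with no atom at the origin and finite second moment is s-finite. -/
lemma sFinite_of_integrable_sq {μ : Measure ℝ} (h0 : μ {0} = 0)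
    (h : Integrable (fun u : ℝ => u ^ 2) μ) : SFinite μ := by
  have hm : MemLp (fun u : ℝ => u ^ 2) 1 μ := memLp_one_iff_integrable.2 h
  obtain ⟨t, -, ht, hσ⟩ := (hm.finStronglyMeasurable_of_stronglyMeasurable
    (by fun_prop : Measurable fun u : ℝ => u ^ 2).stronglyMeasurable one_ne_zero
    ENNReal.one_ne_top).exists_set_sigmaFinite
  have htc : μ tᶜ = 0 := measure_mono_null (fun x hx => by simpa using ht x hx) h0
  have : μ.restrict t = μ := Measure.restrict_eq_self_of_ae_mem (by simpa [mem_ae_iff] using htc)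
  rw [← this]
  infer_instance

/-- A Lévy measure with exponential moments has a finite second moment. -/
lemma integrable_sq_of_exp_moments {μ : Measure ℝ}
    (hμint : Integrable (fun u : ℝ => min 1 (u ^ 2)) μ)
    (hμexp : ∀ C : ℝ, Integrable (fun u : ℝ => Real.exp (C * u)) (μ.restrict {u : ℝ | 1 ≤ |u|})) :
    Integrable (fun u : ℝ => u ^ 2) μ := by
  have hS : MeasurableSet {u : ℝ | 1 ≤ |u|} := measurableSet_le (by fun_prop) (by fun_prop)
  have h1 : IntegrableOn (fun u : ℝ => u ^ 2) {u : ℝ | 1 ≤ |u|} μ := by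
    refine (((hμexp 1).add (hμexp (-1))).const_mul 2).mono' (by fun_prop) (ae_of_all _ fun u => ?_)
    have e1 := Real.quadratic_le_exp_of_nonneg (abs_nonneg u)
    have e2 : Real.exp |u| ≤ Real.exp (1 * u) + Real.exp (-1 * u) := by
      rcases abs_cases u with ⟨h, -⟩ | ⟨h, -⟩ <;> rw [h] <;> simp [Real.exp_nonneg]
    rw [Real.norm_of_nonneg (sq_nonneg u)]
    simp only [Pi.add_apply]
    rw [sq_abs] at e1
    linarith [abs_nonneg u]
  have h2 : IntegrableOn (fun u : ℝ => u ^ 2) {u : ℝ | 1 ≤ |u|}ᶜ μ := by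
    refine hμint.integrableOn.congr_fun (fun u hu => ?_) hS.compl
    have : |u| < 1 := by simpa using hu
    exact min_eq_right ((sq_lt_one_iff_abs_lt_one u).2 this).le
  rw [← integrableOn_univ, ← union_compl_self {u : ℝ | 1 ≤ |u|}]
  exact h1.union h2

/-- A real function whose positive part is nonzero in `L²` exceeds a positive level on a set
of positive measure. -/
lemma exists_pos_measure_ge {α : Type*} [MeasurableSpace α] {ν : Measure α} {f : α → ℝ}
    (h : 0 < ∫ s, max (f s) 0 ^ 2 ∂ν) : ∃ δ > (0 : ℝ), 0 < ν {s | δ ≤ f s} := by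
  by_contra! hc
  have hall : ∀ᵐ s ∂ν, ∀ n : ℕ, ¬ (1 / ((n : ℝ) + 1) ≤ f s) := by
    rw [ae_all_iff]
    intro n
    simpa [ae_iff] using hc (1 / ((n : ℝ) + 1)) (by positivity)
  have hz : (fun s => max (f s) 0 ^ 2) =ᵐ[ν] fun _ => 0 := by
    filter_upwards [hall] with s hs
    have : f s ≤ 0 := by
      by_contra! hpos
      obtain ⟨n, hn⟩ := exists_nat_one_div_lt hpos
      exact hs n hn.le
    simp [this]
  rw [integral_congr_ae hz] at h
  simp at h

lemma integrable_one_sub_cos {κ : Measure ℝ} [IsFiniteMeasure κ] (w : ℝ) :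
    Integrable (fun y : ℝ => 1 - Real.cos (w * y)) κ :=
  Integrable.of_bound (C := 2) (by fun_prop) (ae_of_all _ fun y => by
    rw [Real.norm_eq_abs, abs_le]
    constructor <;> linarith [Real.cos_le_one (w * y), Real.neg_one_le_cos (w * y)])

lemma integral_one_sub_cos {κ : Measure ℝ} [IsFiniteMeasure κ] (w : ℝ) :
    ∫ y, (1 - Real.cos (w * y)) ∂κ
      = κ.real univ - (∫ y : ℝ, Complex.exp (Complex.I * y * w) ∂κ).re := by
  have hexp : ∀ y : ℝ, Complex.exp (Complex.I * y * w) = Complex.exp ((w * y : ℝ) * Complex.I) :=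
    fun y => by congr 1; push_cast; ring
  have hi : Integrable (fun y : ℝ => Complex.exp (Complex.I * y * w)) κ := by
    refine Integrable.of_bound (C := 1) (by fun_prop) (ae_of_all _ fun y => ?_)
    rw [hexp, Complex.norm_exp_ofReal_mul_I]
  have hre : (∫ y : ℝ, Complex.exp (Complex.I * y * w) ∂κ).re = ∫ y, Real.cos (w * y) ∂κ := by
    have := integral_re hi
    simp only [RCLike.re_to_complex] at this
    rw [← this]
    congr 1 with y
    rw [hexp, Complex.exp_ofReal_mul_I_re]
  have hc : Integrable (fun y : ℝ => Real.cos (w * y)) κ :=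
    Integrable.of_bound (C := 1) (by fun_prop) (ae_of_all _ fun y => Real.abs_cos_le_one _)
  rw [hre, integral_sub (integrable_const _) hc]
  simp

/-- Near the origin, `∫ (1 - cos (w y)) κ(dy)` grows at least quadratically in `w`. -/
lemma exists_quadratic_le_integral_one_sub_cos {κ : Measure ℝ} [IsFiniteMeasure κ] {ρ : ℝ}
    (hρ : 0 < ρ) (hκ : κ (Ici ρ) ≠ 0) :
    ∃ η > (0 : ℝ), ∃ c > (0 : ℝ), ∀ w : ℝ, |w| ≤ η →
      c * w ^ 2 ≤ ∫ y, (1 - Real.cos (w * y)) ∂κ := by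
  have hU : Ici ρ ⊆ ⋃ n : ℕ, Icc ρ (n : ℝ) := fun x hx => by
    obtain ⟨n, hn⟩ := exists_nat_ge x
    exact mem_iUnion.2 ⟨n, hx, hn⟩
  obtain ⟨n, hn⟩ := exists_measure_pos_of_not_measure_iUnion_null
    (fun h => hκ (measure_mono_null hU h))
  have hreal : 0 < κ.real (Icc ρ (n : ℝ)) := ENNReal.toReal_pos hn.ne' (measure_ne_top _ _)
  refine ⟨1 / ((n : ℝ) + 1), by positivity,
    κ.real (Icc ρ (n : ℝ)) * (2 / Real.pi ^ 2 * ρ ^ 2), by positivity, fun w hw => ?_⟩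
  have hle : ∫ y, (Icc ρ (n : ℝ)).indicator (fun _ => 2 / Real.pi ^ 2 * ρ ^ 2 * w ^ 2) y ∂κ
      ≤ ∫ y, (1 - Real.cos (w * y)) ∂κ := by
    refine integral_mono ((integrable_const _).indicator measurableSet_Icc)
      (integrable_one_sub_cos w) fun y => ?_
    by_cases hy : y ∈ Icc ρ (n : ℝ)
    · have hy0 : 0 < y := hρ.trans_le hy.1
      have habs : |w * y| ≤ Real.pi := by
        have h1 : |w * y| ≤ 1 := by
          rw [abs_mul, abs_of_pos hy0]
          calc |w| * y ≤ 1 / ((n : ℝ) + 1) * ((n : ℝ) + 1) := by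
                gcongr
                linarith [hy.2]
            _ = 1 := by field_simp
        linarith [Real.pi_gt_three]
      have hq := Real.cos_le_one_sub_mul_cos_sq habs
      have hsq : 2 / Real.pi ^ 2 * ρ ^ 2 * w ^ 2 ≤ 2 / Real.pi ^ 2 * (w * y) ^ 2 := by
        rw [mul_pow, mul_assoc, mul_comm (w ^ 2)]
        have := hy.1
        gcongr
      simp only [indicator_of_mem hy]
      linarith
    · simp only [indicator_of_notMem hy]
      linarith [Real.cos_le_one (w * y)]
  rw [integral_indicator_const _ measurableSet_Icc, smul_eq_mul] at hle
  linarith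

/-- Under Cramer's condition, `∫ (1 - cos (w y)) κ(dy)` dominates `min (w², 1)`. -/
lemma exists_min_le_integral_one_sub_cos {κ : Measure ℝ} [IsFiniteMeasure κ] {ρ : ℝ}
    (hρ : 0 < ρ) (hκ : κ (Ici ρ) ≠ 0)
    (hC : ∀ ε > (0 : ℝ), ∃ c : ℝ, c < κ.real univ ∧ ∀ z : ℝ, ε ≤ |z| →
      ‖∫ y : ℝ, Complex.exp (Complex.I * y * z) ∂κ‖ ≤ c) :
    ∃ c > (0 : ℝ), ∀ w : ℝ, c * min (w ^ 2) 1 ≤ ∫ y, (1 - Real.cos (w * y)) ∂κ := by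
  obtain ⟨η, hη, c₁, hc₁, h₁⟩ := exists_quadratic_le_integral_one_sub_cos hρ hκ
  obtain ⟨c₂, hc₂, h₂⟩ := hC η hη
  have hmin : ∀ w : ℝ, 0 ≤ min (w ^ 2) 1 := fun w => le_min (sq_nonneg w) zero_le_one
  refine ⟨min c₁ (κ.real univ - c₂), lt_min hc₁ (sub_pos.2 hc₂), fun w => ?_⟩
  rcases le_total |w| η with hw | hw
  · calc min c₁ (κ.real univ - c₂) * min (w ^ 2) 1 ≤ c₁ * w ^ 2 :=
          mul_le_mul (min_le_left _ _) (min_le_left _ _) (hmin w) hc₁.le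
      _ ≤ _ := h₁ w hw
  · calc min c₁ (κ.real univ - c₂) * min (w ^ 2) 1 ≤ (κ.real univ - c₂) * 1 :=
          mul_le_mul (min_le_right _ _) (min_le_right _ _) (hmin w) (sub_pos.2 hc₂).le
      _ ≤ _ := by
          rw [integral_one_sub_cos]
          linarith [h₂ w hw, Complex.re_le_norm (∫ y : ℝ, Complex.exp (Complex.I * y * w) ∂κ)]

lemma indicator_mul_one_sub_cos_nonneg (A : Set ℝ) (a x : ℝ) :
    0 ≤ A.indicator (fun _ => (1 : ℝ)) a * (1 - Real.cos x) :=
  mul_nonneg (indicator_nonneg (fun _ _ => zero_le_one) _) (by linarith [Real.cos_le_one x])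

lemma indicator_mul_one_sub_cos_le {q : ℝ} (hq : 0 < q) (a u x : ℝ) :
    (Ici q).indicator (fun _ => (1 : ℝ)) (a * u) * (1 - Real.cos x)
      ≤ 2 / q ^ 2 * a ^ 2 * u ^ 2 := by
  by_cases h : a * u ∈ Ici q
  · have h1 : q ^ 2 ≤ (a * u) ^ 2 := pow_le_pow_left₀ hq.le h 2
    have h2 : 2 ≤ 2 / q ^ 2 * (a * u) ^ 2 := by
      rw [div_mul_eq_mul_div, le_div_iff₀ (by positivity)]
      linarith
    rw [indicator_of_mem h, one_mul, mul_assoc, ← mul_pow]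
    linarith [Real.neg_one_le_cos x]
  · rw [indicator_of_notMem h, zero_mul]
    positivity

lemma measurable_indicator_mul_one_sub_cos {f : ℝ → ℝ} (hf : Measurable f) (q z : ℝ) :
    Measurable fun p : ℝ × ℝ =>
      (Ici q).indicator (fun _ => (1 : ℝ)) (f p.1 * p.2) * (1 - Real.cos (f p.1 * z * p.2)) := by
  have h : Measurable ((Ici q).indicator fun _ : ℝ => (1 : ℝ)) :=
    measurable_const.indicator measurableSet_Ici
  exact (h.comp (by fun_prop : Measurable fun p : ℝ × ℝ => f p.1 * p.2)).mul (by fun_prop)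

lemma integrable_indicator_mul_one_sub_cos {μ : Measure ℝ}
    (hμ : Integrable (fun u : ℝ => u ^ 2) μ) {f : ℝ → ℝ} (hf : Measurable f)
    {q : ℝ} (hq : 0 < q) (z s : ℝ) :
    Integrable (fun u : ℝ =>
      (Ici q).indicator (fun _ => (1 : ℝ)) (f s * u) * (1 - Real.cos (f s * z * u))) μ := by
  refine (hμ.const_mul (2 / q ^ 2 * f s ^ 2)).mono'
    ((measurable_indicator_mul_one_sub_cos hf q z).comp
      measurable_prodMk_left).aestronglyMeasurable (ae_of_all _ fun u => ?_)
  rw [Real.norm_of_nonneg (indicator_mul_one_sub_cos_nonneg _ _ _)]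
  exact indicator_mul_one_sub_cos_le hq _ _ _

lemma integrable_integral_indicator_mul_one_sub_cos {μ ν : Measure ℝ} [SFinite μ]
    (hμ : Integrable (fun u : ℝ => u ^ 2) μ) {f : ℝ → ℝ} (hf : Measurable f)
    (hf2 : Integrable (fun s => f s ^ 2) ν) {q : ℝ} (hq : 0 < q) (z : ℝ) :
    Integrable (fun s => ∫ u, (Ici q).indicator (fun _ => (1 : ℝ)) (f s * u)
      * (1 - Real.cos (f s * z * u)) ∂μ) ν := by
  refine (hf2.const_mul (2 / q ^ 2 * ∫ u, u ^ 2 ∂μ)).mono'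
    (measurable_indicator_mul_one_sub_cos hf q
      z).stronglyMeasurable.integral_prod_right'.aestronglyMeasurable (ae_of_all _ fun s => ?_)
  rw [Real.norm_of_nonneg (integral_nonneg fun u => indicator_mul_one_sub_cos_nonneg _ _ _)]
  calc _ ≤ ∫ u, 2 / q ^ 2 * f s ^ 2 * u ^ 2 ∂μ :=
        integral_mono (integrable_indicator_mul_one_sub_cos hμ hf hq z s) (hμ.const_mul _)
          fun u => indicator_mul_one_sub_cos_le hq _ _ _
    _ = 2 / q ^ 2 * (∫ u, u ^ 2 ∂μ) * f s ^ 2 := by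
        rw [integral_const_mul]
        ring

/-- Lemma 3.5: Cramer's condition for the tail `μ|_{[ρ,∞)}` of the Lévy
measure implies condition (Ĥ₄): there are `q, ϑ > 0` with `Θ(z,[q,∞)) ≥ ϑ·min(ε²,1)`
whenever `|z| ≥ ε`. -/
theorem cramer_implies_H4hat
    (μ : Measure ℝ)
    (hμ0 : μ {0} = 0)
    (hμint : Integrable (fun u : ℝ => min 1 (u ^ 2)) μ)
    (hμpos : 0 < μ (Set.Ioi (0 : ℝ)))
    (hμexp : ∀ C : ℝ, Integrable (fun u : ℝ => Real.exp (C * u)) (μ.restrict {u : ℝ | 1 ≤ |u|}))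
    (I : Set ℝ) (hI : I.OrdConnected)
    (f : ℝ → ℝ) (hfmeas : Measurable f)
    (hfbdd : ∃ C : ℝ, ∀ s ∈ I, |f s| ≤ C)
    (hf2int : IntegrableOn (fun s => f s ^ 2) I)
    (hf2pos : 0 < ∫ s in I, f s ^ 2)
    (hfplus : 0 < ∫ s in I, max (f s) 0 ^ 2)
    (hCramer : ∃ ρ > (0 : ℝ), ∀ ε > (0 : ℝ), ∃ c : ℝ,
      c < (μ (Set.Ici ρ)).toReal ∧
      ∀ z : ℝ, ε ≤ |z| →
        ‖∫ y in Set.Ici ρ, Complex.exp (Complex.I * y * z) ∂μ‖ ≤ c) :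
    ∃ q > (0 : ℝ), ∃ ϑ > (0 : ℝ), ∀ ε > (0 : ℝ), ∀ z : ℝ, ε ≤ |z| →
      ϑ * min (ε ^ 2) 1 ≤ kernelTheta μ I f z (Set.Ici q) := by
  obtain ⟨ρ, hρ, hC⟩ := hCramer
  have hsq := integrable_sq_of_exp_moments hμint hμexp
  have hsf : SFinite μ := sFinite_of_integrable_sq hμ0 hsq
  have hρpos : 0 < (μ (Ici ρ)).toReal := by
    obtain ⟨c, hc, h⟩ := hC 1 one_pos
    exact (norm_nonneg _).trans_lt ((h 1 (by simp)).trans_lt hc)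
  obtain ⟨hρ0, hρtop⟩ := ENNReal.toReal_pos_iff.1 hρpos
  have hfin : IsFiniteMeasure (μ.restrict (Ici ρ)) := ⟨by simpa using hρtop⟩
  obtain ⟨c, hc, hcw⟩ := exists_min_le_integral_one_sub_cos (κ := μ.restrict (Ici ρ)) hρ
    (by simpa using hρ0.ne') (by simpa [Measure.real] using hC)
  obtain ⟨δ, hδ, hP⟩ := exists_pos_measure_ge hfplus
  set P : Set ℝ := {s | δ ≤ f s} with hPdef
  have hPmeas : MeasurableSet P := measurableSet_le measurable_const hfmeas
  have hPtop : volume.restrict I P < ⊤ := by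
    refine (measure_mono fun s (hs : δ ≤ f s) => ?_).trans_lt
      (hf2int.measure_ge_lt_top (ε := δ ^ 2) (by positivity))
    exact pow_le_pow_left₀ hδ.le hs 2
  have hPreal : 0 < (volume.restrict I).real P := ENNReal.toReal_pos hP.ne' hPtop.ne
  refine ⟨δ * ρ, by positivity, (volume.restrict I).real P * (c * min (δ ^ 2) 1), by positivity,
    fun ε hε z hz => ?_⟩
  have hq : 0 < δ * ρ := by positivity
  have hinner : ∀ s ∈ P, c * min (δ ^ 2) 1 * min (ε ^ 2) 1 ≤
      ∫ u, (Ici (δ * ρ)).indicator (fun _ => (1 : ℝ)) (f s * u)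
        * (1 - Real.cos (f s * z * u)) ∂μ := by
    intro s (hs : δ ≤ f s)
    have hw : δ ^ 2 * ε ^ 2 ≤ (f s * z) ^ 2 := by
      rw [mul_pow, ← sq_abs z]
      gcongr
    have hmin : min (δ ^ 2) 1 * min (ε ^ 2) 1 ≤ min ((f s * z) ^ 2) 1 := by
      refine le_min ((mul_le_mul (min_le_left _ _) (min_le_left _ _) (by positivity)
        (by positivity)).trans hw) ?_
      exact mul_le_one₀ (min_le_right _ _) (by positivity) (min_le_right _ _)
    calc c * min (δ ^ 2) 1 * min (ε ^ 2) 1 ≤ c * min ((f s * z) ^ 2) 1 := by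
          rw [mul_assoc]
          gcongr
      _ ≤ ∫ u in Ici ρ, (1 - Real.cos (f s * z * u)) ∂μ := hcw _
      _ = ∫ u in Ici ρ, (Ici (δ * ρ)).indicator (fun _ => (1 : ℝ)) (f s * u)
            * (1 - Real.cos (f s * z * u)) ∂μ := by
          refine setIntegral_congr_fun measurableSet_Ici fun u (hu : ρ ≤ u) => ?_
          have : f s * u ∈ Ici (δ * ρ) := mul_le_mul hs hu hρ.le (hδ.le.trans hs)
          simp only [indicator_of_mem this, one_mul]
      _ ≤ _ := setIntegral_le_integral (integrable_indicator_mul_one_sub_cos hsq hfmeas hq z s)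
          (ae_of_all _ fun u => indicator_mul_one_sub_cos_nonneg _ _ _)
  calc (volume.restrict I).real P * (c * min (δ ^ 2) 1) * min (ε ^ 2) 1
      = ∫ s in I, P.indicator (fun _ => c * min (δ ^ 2) 1 * min (ε ^ 2) 1) s := by
        rw [integral_indicator_const _ hPmeas, smul_eq_mul]
        ring
    _ ≤ kernelTheta μ I f z (Ici (δ * ρ)) := by
        refine integral_mono ((integrable_indicator_iff hPmeas).2
          (integrableOn_const hPtop.ne))
          (integrable_integral_indicator_mul_one_sub_cos hsq hfmeas hf2int hq z) fun s => ?_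
        by_cases hs : s ∈ P
        · simpa only [indicator_of_mem hs] using hinner s hs
        · simp only [indicator_of_notMem hs]
          exact integral_nonneg fun u => indicator_mul_one_sub_cos_nonneg _ _ _
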